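/- arXiv:2309.02570 — 6 statements merged into one kernel-verified Lean document; each statement's English description precedes it below -/
import Mathlib

section
/- (The MINVAR distortion corresponds to the Beta(2,x) distribution.) Fix a real x > 0, and let μ be the Beta(2,x) probability measure on [0,1], i.e. the measure with density s ↦ x(x+1)·s·(1−s)^{x−1} with respect to Lebesgue measure on [0,1]. Then for every y ∈ [0,1], ψ_μ(y) = 1 − (1−y)^{x+1}. -/
open MeasureTheory Set

/-- The distortion function generated by a probability measure `μ` on `[0,1]`:
`ψ_μ(y) = ∫_{[0,y]} (∫_{(z,1]} s⁻¹ μ(ds)) dz`. -/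
noncomputable def psiMu (μ : Measure ℝ) (y : ℝ) : ℝ :=
  ∫ z in Set.Icc (0:ℝ) y, ∫ s in Set.Ioc z 1, s⁻¹ ∂μ

/-- The integral of `s ↦ (1 - s) ^ r` over `(a, b]` for `r > -1`. -/
theorem setIntegral_Ioc_one_sub_rpow {r a b : ℝ} (hr : -1 < r) (hab : a ≤ b) :
    ∫ s in Set.Ioc a b, (1 - s) ^ r = ((1 - a) ^ (r + 1) - (1 - b) ^ (r + 1)) / (r + 1) := by
  rw [← intervalIntegral.integral_of_le hab,
    intervalIntegral.integral_comp_sub_left (fun t : ℝ => t ^ r) 1, integral_rpow (Or.inl hr)]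

/-- The integral of `s⁻¹` over `(z, 1]` against the `Beta(2, x)` distribution. -/
theorem setIntegral_inv_beta_two {x z : ℝ} (hx : 0 < x) (hz : z ∈ Set.Icc (0:ℝ) 1) :
    ∫ s in Set.Ioc z 1, s⁻¹ ∂((volume.restrict (Set.Icc (0:ℝ) 1)).withDensity
      (fun s => ENNReal.ofReal (x * (x + 1) * s * (1 - s) ^ (x - 1)))) =
      (x + 1) * (1 - z) ^ x := by
  have hsub : Set.Ioc z 1 ⊆ Set.Icc (0:ℝ) 1 := fun s hs => ⟨hz.1.trans hs.1.le, hs.2⟩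
  rw [setIntegral_withDensity_eq_setIntegral_toReal_smul (by fun_prop)
      (Filter.Eventually.of_forall fun _ => ENNReal.ofReal_lt_top) _ measurableSet_Ioc,
    Measure.restrict_restrict_of_subset hsub]
  have hcongr : ∀ s ∈ Set.Ioc z 1,
      (ENNReal.ofReal (x * (x + 1) * s * (1 - s) ^ (x - 1))).toReal • s⁻¹ =
        x * (x + 1) * (1 - s) ^ (x - 1) := by
    intro s hs
    have hs0 : 0 < s := hz.1.trans_lt hs.1
    have hs1 : 0 ≤ (1 - s) ^ (x - 1) := Real.rpow_nonneg (sub_nonneg.2 hs.2) _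
    rw [ENNReal.toReal_ofReal (by positivity), smul_eq_mul]
    field_simp
  rw [setIntegral_congr_fun measurableSet_Ioc hcongr, integral_const_mul,
    setIntegral_Ioc_one_sub_rpow (by linarith) hz.2, sub_add_cancel, sub_self,
    Real.zero_rpow hx.ne', sub_zero]
  field_simp

/-- The MINVAR distortion corresponds to the `Beta(2, x)` distribution: if `μ` is the
measure on `[0,1]` with density `s ↦ x(x+1)·s·(1−s)^(x−1)` with respect to Lebesgue measure,
then `ψ_μ(y) = 1 − (1−y)^(x+1)` for every `y ∈ [0,1]`. -/
theorem psiMu_beta_eq_minvar (x : ℝ) (hx : 0 < x)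
    (μ : Measure ℝ)
    (hμ : μ = (volume.restrict (Set.Icc (0:ℝ) 1)).withDensity
      (fun s => ENNReal.ofReal (x * (x + 1) * s * (1 - s) ^ (x - 1)))) :
    ∀ y ∈ Set.Icc (0:ℝ) 1, psiMu μ y = 1 - (1 - y) ^ (x + 1) := by
  intro y hy
  subst hμ
  rw [psiMu, setIntegral_congr_fun measurableSet_Icc fun z hz =>
      setIntegral_inv_beta_two hx ⟨hz.1, hz.2.trans hy.2⟩,
    integral_const_mul, integral_Icc_eq_integral_Ioc,
    setIntegral_Ioc_one_sub_rpow (by linarith) hy.1, sub_zero, Real.one_rpow]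
  field_simp
end

section
/- (The MAXVAR distortion corresponds to a mixture of a power law and a Dirac mass at 1.) Fix a real x > 0. Let ν be the probability measure on [0,1] with density s ↦ (1/(x+1))·s^{1/(x+1) − 1} with respect to Lebesgue measure, and set μ := (x/(x+1))·ν + (1/(x+1))·δ₁, where δ₁ is the Dirac measure at 1. Then μ is a probability measure on [0,1] and for every y ∈ [0,1], ψ_μ(y) = y^{1/(x+1)}. -/
open MeasureTheory Set

/-- The density `s ↦ a * s ^ (a - 1)` on `[0,1]` has total mass one. -/
lemma isProbabilityMeasure_withDensity_rpow {a : ℝ} (ha : 0 < a) :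
    IsProbabilityMeasure ((volume.restrict (Set.Icc (0:ℝ) 1)).withDensity
      (fun s => ENNReal.ofReal (a * s ^ (a - 1)))) := by
  have hint : IntervalIntegrable (fun s : ℝ => a * s ^ (a - 1)) volume 0 1 :=
    (intervalIntegral.intervalIntegrable_rpow' (by linarith)).const_mul a
  refine ⟨?_⟩
  rw [withDensity_apply _ MeasurableSet.univ, Measure.restrict_univ,
    ← Measure.restrict_congr_set Ioc_ae_eq_Icc, ← ofReal_integral_eq_lintegral_ofReal
      ((intervalIntegrable_iff_integrableOn_Ioc_of_le zero_le_one).1 hint),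
    ← intervalIntegral.integral_of_le zero_le_one, intervalIntegral.integral_const_mul,
    integral_rpow (Or.inl (by linarith))]
  · simp [ha.ne']
  · filter_upwards [ae_restrict_mem measurableSet_Ioc] with s hs
    exact mul_nonneg ha.le (Real.rpow_nonneg hs.1.le _)

/-- The integral of `s⁻¹` over `(z,1]` against the density `a * s ^ (a - 1)`. -/
lemma setIntegral_inv_withDensity_rpow {a z : ℝ} (ha : 0 < a) (ha1 : a < 1) (hz : 0 < z)
    (hz1 : z ≤ 1) :
    ∫ s in Set.Ioc z 1, s⁻¹ ∂((volume.restrict (Set.Icc (0:ℝ) 1)).withDensity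
      (fun s => ENNReal.ofReal (a * s ^ (a - 1)))) = a * ((1 - z ^ (a - 1)) / (a - 1)) := by
  have hsub : Set.Ioc z 1 ⊆ Set.Icc (0:ℝ) 1 := fun s hs => ⟨hz.le.trans hs.1.le, hs.2⟩
  rw [setIntegral_withDensity_eq_setIntegral_toReal_smul (by fun_prop) (by simp) _
    measurableSet_Ioc, Measure.restrict_restrict_of_subset hsub]
  have hcongr : ∀ s ∈ Set.Ioc z 1,
      (ENNReal.ofReal (a * s ^ (a - 1))).toReal • s⁻¹ = a * s ^ (a - 2) := by
    intro s hs
    have hs0 : 0 < s := hz.trans hs.1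
    rw [ENNReal.toReal_ofReal (by positivity), smul_eq_mul, mul_assoc,
      ← Real.rpow_neg_one s, ← Real.rpow_add hs0]
    ring_nf
  rw [setIntegral_congr_fun measurableSet_Ioc hcongr,
    ← intervalIntegral.integral_of_le hz1, intervalIntegral.integral_const_mul,
    integral_rpow (Or.inr ⟨by linarith, Set.notMem_uIcc_of_lt hz one_pos⟩), Real.one_rpow]
  ring_nf

/-- The MAXVAR distortion corresponds to the mixture `(x/(x+1))·ν + (1/(x+1))·δ₁`, where `ν`
has density `s ↦ (1/(x+1))·s^(1/(x+1)−1)` on `[0,1]`: the mixture `μ` is a probability measure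
and `ψ_μ(y) = y^(1/(x+1))` for every `y ∈ [0,1]`. -/
theorem psiMu_maxvar (x : ℝ) (hx : 0 < x)
    (ν : Measure ℝ)
    (hν : ν = (volume.restrict (Set.Icc (0:ℝ) 1)).withDensity
      (fun s => ENNReal.ofReal ((1 / (x + 1)) * s ^ (1 / (x + 1) - 1))))
    (μ : Measure ℝ)
    (hμ : μ = ENNReal.ofReal (x / (x + 1)) • ν
      + ENNReal.ofReal (1 / (x + 1)) • Measure.dirac (1:ℝ)) :
    IsProbabilityMeasure μ ∧ ∀ y ∈ Set.Icc (0:ℝ) 1, psiMu μ y = y ^ (1 / (x + 1)) := by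
  have ha : 0 < 1 / (x + 1) := by positivity
  have ha1 : 1 / (x + 1) < 1 := by rw [div_lt_one (by positivity)]; linarith
  have hxa : x / (x + 1) = 1 - 1 / (x + 1) := by field_simp; ring
  rw [hxa] at hμ
  generalize 1 / (x + 1) = a at *
  have hν_prob : IsProbabilityMeasure ν := hν ▸ isProbabilityMeasure_withDensity_rpow ha
  have hμ_prob : IsProbabilityMeasure μ := by
    refine ⟨?_⟩
    rw [hμ]
    simp only [Measure.coe_add, Measure.coe_smul, Pi.add_apply, Pi.smul_apply, measure_univ,
      smul_eq_mul, mul_one]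
    rw [← ENNReal.ofReal_add (by linarith) ha.le]
    simp
  refine ⟨hμ_prob, fun y hy => ?_⟩
  have hinner : ∀ z ∈ Set.Ioo (0:ℝ) y, ∫ s in Set.Ioc z 1, s⁻¹ ∂μ = a * z ^ (a - 1) := by
    intro z hz
    have hz1 : z < 1 := hz.2.trans_le hy.2
    have hbound : ∀ (ρ : Measure ℝ) [IsFiniteMeasure ρ],
        IntegrableOn (fun s : ℝ => s⁻¹) (Set.Ioc z 1) ρ := by
      intro ρ _
      refine Measure.integrableOn_of_bounded (M := z⁻¹) (measure_ne_top _ _)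
        measurable_inv.aestronglyMeasurable ?_
      filter_upwards [ae_restrict_mem measurableSet_Ioc] with s hs
      rw [Real.norm_of_nonneg (inv_nonneg.2 (hz.1.trans hs.1).le)]
      exact inv_anti₀ hz.1 hs.1.le
    rw [hμ, Measure.restrict_add, Measure.restrict_smul, Measure.restrict_smul,
      integral_add_measure ((hbound ν).smul_measure ENNReal.ofReal_ne_top)
        ((hbound (Measure.dirac 1)).smul_measure ENNReal.ofReal_ne_top),
      integral_smul_measure, integral_smul_measure, hν,
      setIntegral_inv_withDensity_rpow ha ha1 hz.1 hz1.le,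
      restrict_dirac' measurableSet_Ioc, if_pos ⟨hz1, le_rfl⟩, integral_dirac,
      ENNReal.toReal_ofReal (by linarith), ENNReal.toReal_ofReal ha.le]
    have hne : a - 1 ≠ 0 := by linarith
    simp only [smul_eq_mul, inv_one, mul_one]
    field_simp
    ring
  rw [psiMu, integral_Icc_eq_integral_Ioo, setIntegral_congr_fun measurableSet_Ioo hinner,
    ← integral_Ioc_eq_integral_Ioo, ← intervalIntegral.integral_of_le hy.1,
    intervalIntegral.integral_const_mul, integral_rpow (Or.inl (by linarith))]
  simp only [sub_add_cancel, Real.zero_rpow ha.ne', sub_zero]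
  field_simp
end

section
/- Let μ be a probability measure on [0,1] with μ({0}) = 0 which does not belong to 𝒫′, and set m_μ := ∫_{(0,1)} z·ψ′_μ(z) dz, where ψ′_μ(z) = ∫_{(z,1]} s⁻¹ μ(ds). Then ψ_μ(m_μ) + m_μ − 1 < 0. -/
open MeasureTheory Set

/-- The right derivative of `ψ_μ`: `ψ′_μ(z) = ∫_{(z,1]} s⁻¹ μ(ds)`. -/
noncomputable def psiMu' (μ : Measure ℝ) (z : ℝ) : ℝ :=
  ∫ s in Set.Ioc z 1, s⁻¹ ∂μ

/-- `μ` belongs to the family `𝒫′` of measures `((a−1)/a)·δ_{1/(a+1)} + (1/a)·δ₁`, `a ≥ 1`. -/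
def MemP' (μ : Measure ℝ) : Prop :=
  ∃ a : ℝ, 1 ≤ a ∧
    μ = ENNReal.ofReal ((a - 1) / a) • Measure.dirac (1 / (a + 1))
      + ENNReal.ofReal (1 / a) • Measure.dirac (1:ℝ)

/-- The Fubini theorem for integrals against `ψ′_μ`. -/
theorem integral_mul_psiMu' (μ : Measure ℝ) [IsProbabilityMeasure μ]
    (hμ : ∀ᵐ s ∂μ, s ∈ Ioc (0:ℝ) 1) {k : ℝ → ℝ} (hk : Measurable k)
    (hk0 : ∀ z, 0 ≤ k z) (hk1 : ∀ z, k z ≤ 1) :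
    ∫ z in Ioi (0:ℝ), k z * psiMu' μ z = ∫ s, (s⁻¹ * ∫ z in Ioo 0 s, k z) ∂μ := by
  set F : ℝ × ℝ → ℝ :=
    {p : ℝ × ℝ | p.1 < p.2 ∧ p.2 ≤ 1}.indicator (fun p => k p.1 * p.2⁻¹) with hF
  have hFm : Measurable F := by
    refine Measurable.indicator (by fun_prop) ?_
    exact (measurableSet_lt measurable_fst measurable_snd).inter
      (measurableSet_le measurable_snd measurable_const)
  have hFs : ∀ s ∈ Ioc (0:ℝ) 1, (fun z => F (z, s)) = (Iio s).indicator (fun z => k z * s⁻¹) := by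
    intro s hs
    ext z
    simp [hF, indicator, hs.2]
  have hF0 : ∀ s ∈ Ioc (0:ℝ) 1, ∀ z, 0 ≤ F (z, s) := by
    intro s hs z
    rw [congrFun (hFs s hs) z]
    exact indicator_nonneg (fun z _ => mul_nonneg (hk0 z) (inv_nonneg.2 hs.1.le)) z
  have hint : ∀ s ∈ Ioc (0:ℝ) 1,
      ∫ z in Ioi (0:ℝ), F (z, s) = s⁻¹ * ∫ z in Ioo 0 s, k z := by
    intro s hs
    rw [hFs s hs, setIntegral_indicator measurableSet_Iio, Ioi_inter_Iio, integral_mul_const,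
      mul_comm]
  have hki : ∀ s : ℝ, IntegrableOn k (Ioo 0 s) := fun s =>
    Measure.integrableOn_of_bounded (M := 1) (by simp) hk.aestronglyMeasurable
      (.of_forall fun z => by rw [Real.norm_of_nonneg (hk0 z)]; exact hk1 z)
  have hFi : Integrable F ((volume.restrict (Ioi (0:ℝ))).prod μ) := by
    rw [integrable_prod_iff' hFm.aestronglyMeasurable]
    constructor
    · filter_upwards [hμ] with s hs
      rw [hFs s hs, integrable_indicator_iff measurableSet_Iio, IntegrableOn,
        Measure.restrict_restrict measurableSet_Iio, inter_comm, Ioi_inter_Iio]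
      exact (hki s).mul_const _
    · refine Integrable.of_bound (C := 1) ?_ ?_
      · exact hFm.stronglyMeasurable.norm.integral_prod_left'.aestronglyMeasurable
      · filter_upwards [hμ] with s hs
        have h1 : ∫ z in Ioi (0:ℝ), ‖F (z, s)‖ = s⁻¹ * ∫ z in Ioo 0 s, k z := by
          rw [← hint s hs]
          exact integral_congr_ae (.of_forall fun z => Real.norm_of_nonneg (hF0 s hs z))
        have h2 : ∫ z in Ioo 0 s, k z ≤ s := by
          calc ∫ z in Ioo 0 s, k z ≤ ∫ z in Ioo 0 s, (1:ℝ) :=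
                integral_mono (hki s) (integrable_const _) hk1
            _ = s := by simp [hs.1.le]
        have h3 : 0 ≤ ∫ z in Ioo 0 s, k z := integral_nonneg hk0
        have hs' := inv_pos.2 hs.1
        rw [h1, Real.norm_of_nonneg (by positivity)]
        calc s⁻¹ * ∫ z in Ioo 0 s, k z ≤ s⁻¹ * s := by gcongr
          _ = 1 := inv_mul_cancel₀ hs.1.ne'
  calc ∫ z in Ioi (0:ℝ), k z * psiMu' μ z = ∫ z in Ioi (0:ℝ), ∫ s, F (z, s) ∂μ := by
        refine integral_congr_ae (.of_forall fun z => ?_)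
        dsimp only
        rw [psiMu', ← integral_const_mul, ← integral_indicator measurableSet_Ioc]
        rfl
    _ = ∫ s, (∫ z in Ioi (0:ℝ), F (z, s)) ∂μ := integral_integral_swap (f := fun z s => F (z, s)) hFi
    _ = _ := by
        refine integral_congr_ae ?_
        filter_upwards [hμ] with s hs using hint s hs

/-- `ψ_μ(y)` as a mixture of the functions `y ↦ min s y / s`. -/
theorem psiMu_eq_integral (μ : Measure ℝ) [IsProbabilityMeasure μ]
    (hμ : ∀ᵐ s ∂μ, s ∈ Ioc (0:ℝ) 1) {y : ℝ} (hy : 0 ≤ y) :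
    psiMu μ y = ∫ s, min s y / s ∂μ := by
  have h := integral_mul_psiMu' μ hμ (k := (Iic y).indicator 1)
    (measurable_one.indicator measurableSet_Iic)
    (indicator_nonneg fun _ _ => zero_le_one) (indicator_le_self' fun _ _ => zero_le_one)
  calc psiMu μ y = ∫ z in Ioi (0:ℝ), (Iic y).indicator 1 z * psiMu' μ z := by
        rw [psiMu, integral_Icc_eq_integral_Ioc, ← Ioi_inter_Iic,
          ← setIntegral_indicator measurableSet_Iic]
        refine integral_congr_ae (.of_forall fun z => ?_)
        by_cases hz : z ≤ y <;> simp [indicator, hz, psiMu']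
    _ = _ := h
    _ = _ := by
        refine integral_congr_ae ?_
        filter_upwards [hμ] with s hs
        have hz : ∫ z in Ioo 0 s, (Iic y).indicator (1 : ℝ → ℝ) z = min s y := by
          rw [← integral_Ioc_eq_integral_Ioo, setIntegral_indicator measurableSet_Iic,
            ← Ioi_inter_Iic, inter_assoc, Iic_inter_Iic, Ioi_inter_Iic]
          simp [hs.1.le, hy]
        rw [hz]
        ring

/-- `m_μ` is half the mean of `μ`. -/
theorem integral_id_mul_psiMu' (μ : Measure ℝ) [IsProbabilityMeasure μ]
    (hμ : ∀ᵐ s ∂μ, s ∈ Ioc (0:ℝ) 1) :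
    ∫ z in Ioo (0:ℝ) 1, z * psiMu' μ z = ∫ s, s / 2 ∂μ := by
  have h := integral_mul_psiMu' μ hμ (k := (Ioo 0 1).indicator id)
    (measurable_id.indicator measurableSet_Ioo)
    (indicator_nonneg fun z hz => hz.1.le)
    (fun z => indicator_apply_le' (fun hz => hz.2.le) fun _ => zero_le_one)
  calc ∫ z in Ioo (0:ℝ) 1, z * psiMu' μ z
      = ∫ z in Ioi (0:ℝ), (Ioo 0 1).indicator id z * psiMu' μ z := by
        simp_rw [← indicator_mul_left]
        rw [setIntegral_indicator measurableSet_Ioo,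
          inter_eq_self_of_subset_right fun z hz => hz.1]
        rfl
    _ = _ := h
    _ = _ := by
        refine integral_congr_ae ?_
        filter_upwards [hμ] with s hs
        have hz : ∫ z in Ioo 0 s, (Ioo 0 1).indicator (id : ℝ → ℝ) z = s ^ 2 / 2 := by
          rw [setIntegral_indicator measurableSet_Ioo,
            inter_eq_self_of_subset_left (Ioo_subset_Ioo_right hs.2),
            ← integral_Ioc_eq_integral_Ioo, ← intervalIntegral.integral_of_le hs.1.le]
          simp
        have hs0 := hs.1.ne'
        rw [hz]
        field_simp

/-- A probability measure concentrated on `{m, 1}` with mean `2m` belongs to `𝒫′`. -/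
theorem memP'_of_ae_eq_or (μ : Measure ℝ) [IsProbabilityMeasure μ] {m : ℝ} (hm0 : 0 < m)
    (hm : m ≤ 1 / 2) (hmean : ∫ s, s ∂μ = 2 * m) (h : ∀ᵐ s ∂μ, s = m ∨ s = 1) :
    MemP' μ := by
  have hm1 : m ≠ 1 := by linarith
  have hμ : μ = μ {m} • Measure.dirac m + μ {1} • Measure.dirac 1 := by
    have h1 : μ.restrict ({m} ∪ {1}) = μ :=
      Measure.restrict_eq_self_of_ae_mem (by filter_upwards [h] with s hs using hs)
    rw [Measure.restrict_union (by simpa using hm1) (measurableSet_singleton _),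
      Measure.restrict_singleton, Measure.restrict_singleton] at h1
    exact h1.symm
  have hmass : μ.real {m} + μ.real {1} = 1 := by
    have := congrArg (fun ν : Measure ℝ => ν.real univ) hμ
    simpa [measureReal_def, ENNReal.toReal_add] using this.symm
  have hmean' : μ.real {m} * m + μ.real {1} = 2 * m := by
    rw [← hmean]
    conv_rhs => rw [hμ]
    rw [integral_add_measure, integral_smul_measure, integral_smul_measure]
    · simp [measureReal_def]
    · exact (integrable_dirac (by simp)).smul_measure (measure_ne_top _ _)
    · exact (integrable_dirac (by simp)).smul_measure (measure_ne_top _ _)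
  have h1m : 1 - m ≠ 0 := by linarith
  have hp : μ.real {1} = m / (1 - m) := by
    rw [eq_div_iff h1m]
    linear_combination hmean' - m * hmass
  have hq : μ.real {m} = (1 - 2 * m) / (1 - m) := by
    rw [eq_div_iff h1m]
    linear_combination hmass - hmean'
  refine ⟨(1 - m) / m, by rw [le_div_iff₀ hm0]; linarith, ?_⟩
  have e1 : ((1 - m) / m - 1) / ((1 - m) / m) = μ.real {m} := by rw [hq]; field_simp; ring
  have e2 : 1 / ((1 - m) / m) = μ.real {1} := by rw [hp]; field_simp
  have e3 : 1 / ((1 - m) / m + 1) = m := by field_simp; ring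
  rw [e1, e2, e3, ofReal_measureReal, ofReal_measureReal]
  exact hμ

/-- For a probability measure `μ` on `[0,1]` with `μ({0}) = 0` not in `𝒫′`, setting
`m_μ = ∫_{(0,1)} z·ψ′_μ(z) dz`, one has `ψ_μ(m_μ) + m_μ − 1 < 0`. -/
theorem psiMu_mMu_add_mMu_sub_one_neg (μ : Measure ℝ) [IsProbabilityMeasure μ]
    (hμsupp : μ (Set.Icc (0:ℝ) 1)ᶜ = 0) (hμ0 : μ {0} = 0) (hμP' : ¬ MemP' μ) :
    psiMu μ (∫ z in Set.Ioo (0:ℝ) 1, z * psiMu' μ z)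
      + (∫ z in Set.Ioo (0:ℝ) 1, z * psiMu' μ z) - 1 < 0 := by
  have hμ : ∀ᵐ s ∂μ, s ∈ Ioc (0:ℝ) 1 := by
    have h1 : ∀ᵐ s ∂μ, s ∈ Icc (0:ℝ) 1 := hμsupp
    have h2 : ∀ᵐ s ∂μ, s ≠ 0 := by simpa [ae_iff] using hμ0
    filter_upwards [h1, h2] with s hs hs0 using ⟨hs.1.lt_of_ne' hs0, hs.2⟩
  have hid : Integrable (fun s : ℝ => s) μ :=
    Integrable.of_bound (C := 1) aestronglyMeasurable_id (by
      filter_upwards [hμ] with s hs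
      rw [Real.norm_of_nonneg hs.1.le]
      exact hs.2)
  rw [integral_id_mul_psiMu' μ hμ]
  set m := ∫ s, s / 2 ∂μ with hm
  have hmean : ∫ s, s ∂μ = 2 * m := by rw [hm, integral_div]; ring
  have hm0 : 0 < m := by
    have hnn : 0 ≤ᵐ[μ] fun s : ℝ => s := by filter_upwards [hμ] with s hs using hs.1.le
    have : 0 < ∫ s, s ∂μ := by
      refine (integral_nonneg_of_ae hnn).lt_of_ne' fun h0 => ?_
      have h0' := (integral_eq_zero_iff_of_nonneg_ae hnn hid).1 h0
      obtain ⟨s, hs, hs0⟩ := (hμ.and h0').exists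
      exact hs.1.ne' hs0
    linarith
  have hm1 : m ≤ 1 / 2 := by
    have : ∫ s, s ∂μ ≤ ∫ _, (1:ℝ) ∂μ :=
      integral_mono_ae hid (integrable_const _) (by filter_upwards [hμ] with s hs using hs.2)
    simp only [integral_const, probReal_univ, smul_eq_mul, mul_one] at this
    linarith
  rw [psiMu_eq_integral μ hμ hm0.le]
  have hmin : Integrable (fun s : ℝ => min s m / s) μ :=
    Integrable.of_bound (C := 1) (by exact Measurable.aestronglyMeasurable (by fun_prop)) (by
      filter_upwards [hμ] with s hs
      rw [Real.norm_of_nonneg (div_nonneg (le_min hs.1.le hm0.le) hs.1.le), div_le_one hs.1]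
      exact min_le_left _ _)
  have hlin : Integrable (fun s : ℝ => 1 + m - s) μ := (integrable_const _).sub hid
  have hgap : Integrable (fun s : ℝ => 1 + m - s - min s m / s) μ := hlin.sub hmin
  have hgap_eq : ∫ s, (1 + m - s - min s m / s) ∂μ = 1 - m - ∫ s, min s m / s ∂μ := by
    rw [integral_sub hlin hmin, integral_sub (integrable_const _) hid,
      hmean]
    simp only [integral_const, probReal_univ, smul_eq_mul, one_mul]
    ring
  have hgap_of_le : ∀ s : ℝ, 0 < s → m ≤ s →
      1 + m - s - min s m / s = (s - m) * (1 - s) / s := by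
    intro s hs hms
    rw [min_eq_right hms]
    field_simp
    ring
  have hgap_of_lt : ∀ s : ℝ, 0 < s → s < m → 1 + m - s - min s m / s = m - s := by
    intro s hs hsm
    rw [min_eq_left hsm.le, div_self hs.ne']
    ring
  have hnn : 0 ≤ᵐ[μ] fun s : ℝ => 1 + m - s - min s m / s := by
    filter_upwards [hμ] with s hs
    rcases le_or_gt m s with hms | hsm
    · rw [hgap_of_le s hs.1 hms]
      exact div_nonneg (mul_nonneg (sub_nonneg.2 hms) (sub_nonneg.2 hs.2)) hs.1.le
    · rw [hgap_of_lt s hs.1 hsm]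
      exact sub_nonneg.2 hsm.le
  have hpos : 0 < ∫ s, (1 + m - s - min s m / s) ∂μ := by
    refine (integral_nonneg_of_ae hnn).lt_of_ne' fun h0 => hμP' ?_
    refine memP'_of_ae_eq_or μ hm0 hm1 hmean ?_
    filter_upwards [hμ, (integral_eq_zero_iff_of_nonneg_ae hnn hgap).1 h0] with s hs hs0
    rw [Pi.zero_apply] at hs0
    rcases le_or_gt m s with hms | hsm
    · rw [hgap_of_le s hs.1 hms, div_eq_zero_iff, mul_eq_zero] at hs0
      rcases hs0 with (h | h) | h
      · exact .inl (by linarith)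
      · exact .inr (by linarith)
      · exact absurd h hs.1.ne'
    · rw [hgap_of_lt s hs.1 hsm] at hs0
      linarith
  linarith
end

section
/- Let μ be a probability measure on [0,1] with μ({0}) = 0 which does not belong to 𝒫′, and set m_μ := ∫_{(0,1)} z·ψ′_μ(z) dz, where ψ′_μ(z) = ∫_{(z,1]} s⁻¹ μ(ds). Then there exist real numbers a, b, c, d satisfying: (i) a < 0 < d, a < b < c < d, and 2(c−b) = d−a; (ii) (a+d)/(a−d) + ψ_μ(2(b−a)/(d−a)) ≤ m_μ; (iii) 2b/(a−d) ≤ m_μ; and (iv) m_μ < a/(a−d). -/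
open MeasureTheory Set

/-- The integrand of `psiMu'`, extended to the whole line. -/
noncomputable def invKernel (z s : ℝ) : ℝ := if z < s then s⁻¹ else 0

lemma measurable_invKernel : Measurable (Function.uncurry invKernel) :=
  Measurable.ite (measurableSet_lt measurable_fst measurable_snd) measurable_snd.inv
    measurable_const

lemma setIntegral_mul_invKernel (g : ℝ → ℝ) {s : ℝ} (hs : s ∈ Ioc (0:ℝ) 1) :
    ∫ z in Ioc (0:ℝ) 1, g z * invKernel z s = s⁻¹ * ∫ z in Ioc (0:ℝ) s, g z := by
  have h : (fun z => g z * invKernel z s) = (Iio s).indicator (fun z => s⁻¹ * g z) := by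
    ext z
    by_cases hz : z < s <;> simp [invKernel, hz, mul_comm]
  have hset : Ioc (0:ℝ) 1 ∩ Iio s = Ioo 0 s := by
    ext z
    simp only [mem_inter_iff, mem_Ioc, mem_Iio, mem_Ioo]
    exact ⟨fun h => ⟨h.1.1, h.2⟩, fun h => ⟨⟨h.1, h.2.le.trans hs.2⟩, h.2⟩⟩
  rw [h, setIntegral_indicator measurableSet_Iio, hset, ← integral_Ioc_eq_integral_Ioo,
    integral_const_mul]

lemma inv_mul_min_le {m s : ℝ} (hs : s ∈ Ioc (0:ℝ) 1) :
    s⁻¹ * min s m ≤ 1 + m - s := by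
  rw [inv_mul_le_iff₀ hs.1]
  rcases le_total s m with h | h
  · rw [min_eq_left h]
    nlinarith [hs.1]
  · rw [min_eq_right h]
    nlinarith [hs.2]

lemma eq_or_eq_of_inv_mul_min_eq {m s : ℝ} (hs : s ∈ Ioc (0:ℝ) 1)
    (h : s⁻¹ * min s m = 1 + m - s) : s = m ∨ s = 1 := by
  have hs0 := hs.1.ne'
  rw [inv_mul_eq_iff_eq_mul₀ hs0] at h
  rcases le_total s m with hsm | hsm
  · rw [min_eq_left hsm] at h
    have : s * (m - s) = 0 := by linear_combination -h
    left
    rcases mul_eq_zero.1 this with h' | h'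
    · exact absurd h' hs0
    · linarith
  · rw [min_eq_right hsm] at h
    have : (s - m) * (s - 1) = 0 := by linear_combination h
    rcases mul_eq_zero.1 this with h' | h'
    · left; linarith
    · right; linarith

section

variable {μ : Measure ℝ}

lemma ae_mem_Ioc (hμsupp : μ (Icc (0:ℝ) 1)ᶜ = 0) (hμ0 : μ {0} = 0) :
    ∀ᵐ s ∂μ, s ∈ Ioc (0:ℝ) 1 := by
  have h1 : ∀ᵐ s ∂μ, s ∈ Icc (0:ℝ) 1 := hμsupp
  have h0 : ∀ᵐ s ∂μ, s ≠ 0 := by simpa [ae_iff] using hμ0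
  filter_upwards [h1, h0] with s hs hs0
  exact ⟨lt_of_le_of_ne hs.1 hs0.symm, hs.2⟩

lemma psiMu'_eq_integral_invKernel (hμ : ∀ᵐ s ∂μ, s ∈ Ioc (0:ℝ) 1) (z : ℝ) :
    psiMu' μ z = ∫ s, invKernel z s ∂μ := by
  rw [psiMu', ← integral_indicator measurableSet_Ioc]
  refine integral_congr_ae ?_
  filter_upwards [hμ] with s hs
  by_cases hz : z < s <;> simp [invKernel, indicator, hz, hs.2]

variable [IsProbabilityMeasure μ]

lemma integrable_invKernel (hμ : ∀ᵐ s ∂μ, s ∈ Ioc (0:ℝ) 1) :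
    Integrable (Function.uncurry invKernel) ((volume.restrict (Ioc (0:ℝ) 1)).prod μ) := by
  rw [integrable_prod_iff' measurable_invKernel.aestronglyMeasurable]
  constructor
  · filter_upwards with s
    refine Integrable.of_bound (C := |s⁻¹|)
      (measurable_invKernel.comp measurable_prodMk_right).aestronglyMeasurable ?_
    filter_upwards with z
    by_cases hz : z < s <;> simp [Function.uncurry, invKernel, hz]
  · refine (integrable_const (1:ℝ)).congr ?_
    filter_upwards [hμ] with s hs
    have h : ∀ z, ‖Function.uncurry invKernel (z, s)‖ = 1 * invKernel z s := by
      intro z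
      by_cases hz : z < s <;> simp [Function.uncurry, invKernel, hz, hs.1.le]
    simp_rw [h]
    rw [setIntegral_mul_invKernel _ hs]
    simp [hs.1.le, hs.1.ne']

lemma setIntegral_mul_psiMu' (hμ : ∀ᵐ s ∂μ, s ∈ Ioc (0:ℝ) 1) {g : ℝ → ℝ} (hg : Measurable g)
    (hb : ∀ z ∈ Ioc (0:ℝ) 1, ‖g z‖ ≤ 1) :
    ∫ z in Ioc (0:ℝ) 1, g z * psiMu' μ z = ∫ s, s⁻¹ * (∫ z in Ioc (0:ℝ) s, g z) ∂μ := by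
  simp_rw [psiMu'_eq_integral_invKernel hμ, ← integral_const_mul]
  rw [integral_integral_swap]
  · refine integral_congr_ae ?_
    filter_upwards [hμ] with s hs
    exact (setIntegral_mul_invKernel g hs).trans (integral_const_mul _ _).symm
  · have hmeas : Measurable fun p : ℝ × ℝ => g p.1 := hg.comp measurable_fst
    refine (integrable_invKernel hμ).bdd_mul (c := 1) hmeas.aestronglyMeasurable ?_
    exact Measure.quasiMeasurePreserving_fst.ae
      ((ae_restrict_iff' measurableSet_Ioc).2 (Filter.Eventually.of_forall hb))

lemma setIntegral_id_mul_psiMu' (hμ : ∀ᵐ s ∂μ, s ∈ Ioc (0:ℝ) 1) :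
    ∫ z in Ioo (0:ℝ) 1, z * psiMu' μ z = (∫ s, s ∂μ) / 2 := by
  rw [← integral_Ioc_eq_integral_Ioo, setIntegral_mul_psiMu' hμ (g := fun z => z) measurable_id
    (fun z hz => by rw [Real.norm_of_nonneg hz.1.le]; exact hz.2), ← integral_div]
  refine integral_congr_ae ?_
  filter_upwards [hμ] with s hs
  rw [← intervalIntegral.integral_of_le hs.1.le, integral_id]
  have := hs.1.ne'
  field_simp
  ring

lemma psiMu_eq_integral_min (hμ : ∀ᵐ s ∂μ, s ∈ Ioc (0:ℝ) 1) {t : ℝ} (ht0 : 0 ≤ t)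
    (ht1 : t ≤ 1) : psiMu μ t = ∫ s, s⁻¹ * min s t ∂μ := by
  have hset : Ioc (0:ℝ) 1 ∩ Iic t = Ioc 0 t := by
    rw [Ioc_inter_Iic, min_eq_right ht1]
  have hpsi : psiMu μ t
      = ∫ z in Ioc (0:ℝ) 1, (Iic t).indicator (fun _ => (1:ℝ)) z * psiMu' μ z := by
    have h : (fun z => (Iic t).indicator (fun _ => (1:ℝ)) z * psiMu' μ z)
        = (Iic t).indicator (psiMu' μ) := by
      ext z
      by_cases hz : z ≤ t <;> simp [hz]
    rw [h, setIntegral_indicator measurableSet_Iic, hset, ← integral_Icc_eq_integral_Ioc]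
    rfl
  rw [hpsi, setIntegral_mul_psiMu' hμ (measurable_const.indicator measurableSet_Iic)]
  · refine integral_congr_ae ?_
    filter_upwards [hμ] with s hs
    rw [setIntegral_indicator measurableSet_Iic, Ioc_inter_Iic]
    simp [hs.1.le, ht0]
  · intro z _
    by_cases hz : z ≤ t <;> simp [hz]

lemma integrable_id_of_ae_mem_Ioc (hμ : ∀ᵐ s ∂μ, s ∈ Ioc (0:ℝ) 1) :
    Integrable (fun s : ℝ => s) μ := by
  refine Integrable.of_bound (C := 1) measurable_id.aestronglyMeasurable ?_
  filter_upwards [hμ] with s hs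
  rw [Real.norm_of_nonneg hs.1.le]
  exact hs.2

lemma integrable_inv_mul_min (hμ : ∀ᵐ s ∂μ, s ∈ Ioc (0:ℝ) 1) {t : ℝ} (ht : 0 ≤ t) :
    Integrable (fun s : ℝ => s⁻¹ * min s t) μ := by
  refine Integrable.of_bound (C := 1) (by fun_prop) ?_
  filter_upwards [hμ] with s hs
  rw [Real.norm_of_nonneg (mul_nonneg (inv_nonneg.2 hs.1.le) (le_min hs.1.le ht)),
    inv_mul_le_iff₀ hs.1, mul_one]
  exact min_le_left _ _

/-- A measure on `(0,1]` carried by `{m, 1}`, where `2m` is its mean, belongs to `𝒫′`. -/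
lemma memP'_of_ae_eq_or_eq {m : ℝ} (hm0 : 0 < m) (hm : m ≤ 1 / 2)
    (hmean : ∫ s, s ∂μ = 2 * m) (h : ∀ᵐ s ∂μ, s = m ∨ s = 1) : MemP' μ := by
  have hne : m ≠ 1 := by linarith
  have hdecomp : μ = μ {m} • Measure.dirac m + μ {1} • Measure.dirac 1 := by
    have hr : μ.restrict ({m} ∪ {1}) = μ :=
      Measure.restrict_eq_self_of_ae_mem (by filter_upwards [h] with s hs using hs)
    rw [← Measure.restrict_singleton, ← Measure.restrict_singleton,
      ← Measure.restrict_union (by simpa using hne) (measurableSet_singleton _), hr]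
  have hmass : μ.real {m} + μ.real {1} = 1 := by
    have h1 : μ {m} + μ {1} = 1 := by
      have := congrArg (fun ν : Measure ℝ => ν univ) hdecomp
      simpa using this.symm
    have := congrArg ENNReal.toReal h1
    rwa [ENNReal.toReal_add (measure_ne_top _ _) (measure_ne_top _ _)] at this
  have hmean' : μ.real {m} * m + μ.real {1} = 2 * m := by
    rw [← hmean]
    conv_rhs => rw [hdecomp]
    rw [integral_add_measure, integral_smul_measure, integral_smul_measure, integral_dirac,
      integral_dirac]
    · simp [Measure.real]
    all_goals exact (integrable_dirac (by simp)).smul_measure (measure_ne_top _ _)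
  have h1m : 0 < 1 - m := by linarith
  have hwm : μ.real {m} = (m⁻¹ - 1 - 1) / (m⁻¹ - 1) := by
    have : m⁻¹ - 1 = (1 - m) / m := by field_simp
    rw [this]
    field_simp
    linear_combination hmass - hmean'
  have hw1 : μ.real {1} = 1 / (m⁻¹ - 1) := by
    have : m⁻¹ - 1 = (1 - m) / m := by field_simp
    rw [this]
    field_simp
    linear_combination hmean' - m * hmass
  refine ⟨m⁻¹ - 1, ?_, ?_⟩
  · have : 2 ≤ m⁻¹ := by
      rw [le_inv_comm₀ two_pos hm0]
      linarith
    linarith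
  · rw [← hwm, ← hw1, ofReal_measureReal, ofReal_measureReal, sub_add_cancel, one_div, inv_inv]
    exact hdecomp

lemma integral_inv_mul_min_lt (hμ : ∀ᵐ s ∂μ, s ∈ Ioc (0:ℝ) 1) (hμP' : ¬ MemP' μ) {m : ℝ}
    (hm0 : 0 < m) (hm : m ≤ 1 / 2) (hmean : ∫ s, s ∂μ = 2 * m) :
    ∫ s, s⁻¹ * min s m ∂μ < 1 - m := by
  have hid := integrable_id_of_ae_mem_Ioc hμ
  have hmin := integrable_inv_mul_min hμ hm0.le
  have hlin : Integrable (fun s => 1 + m - s) μ := (integrable_const _).sub hid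
  have hlin_eq : ∫ s, (1 + m - s) ∂μ = 1 - m := by
    rw [integral_sub (integrable_const _) hid, hmean]
    simp
    ring
  have hle : (fun s => s⁻¹ * min s m) ≤ᵐ[μ] fun s => 1 + m - s := by
    filter_upwards [hμ] with s hs using inv_mul_min_le hs
  refine lt_of_le_of_ne (hlin_eq ▸ integral_mono_ae hmin hlin hle) fun heq => hμP' ?_
  rw [← hlin_eq, integral_eq_iff_of_ae_le hmin hlin hle] at heq
  refine memP'_of_ae_eq_or_eq hm0 hm hmean ?_
  filter_upwards [hμ, heq] with s hs h using eq_or_eq_of_inv_mul_min_eq hs h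

lemma integral_inv_mul_min_le_mul (hμ : ∀ᵐ s ∂μ, s ∈ Ioc (0:ℝ) 1) {m t : ℝ} (hm0 : 0 < m)
    (hmt : m ≤ t) :
    ∫ s, s⁻¹ * min s t ∂μ ≤ t / m * ∫ s, s⁻¹ * min s m ∂μ := by
  rw [← integral_const_mul]
  refine integral_mono_ae (integrable_inv_mul_min hμ (hm0.le.trans hmt))
    ((integrable_inv_mul_min hμ hm0.le).const_mul _) ?_
  filter_upwards [hμ] with s hs
  have hmin : min s t ≤ t / m * min s m := by
    rw [mul_min_of_nonneg _ _ (div_nonneg (hm0.le.trans hmt) hm0.le), div_mul_cancel₀ _ hm0.ne']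
    exact min_le_min_right _ (le_mul_of_one_le_left hs.1.le ((one_le_div hm0).2 hmt))
  calc s⁻¹ * min s t ≤ s⁻¹ * (t / m * min s m) :=
        mul_le_mul_of_nonneg_left hmin (inv_nonneg.2 hs.1.le)
    _ = t / m * (s⁻¹ * min s m) := by ring

lemma integral_pos_of_ae_mem_Ioc (hμ : ∀ᵐ s ∂μ, s ∈ Ioc (0:ℝ) 1) : 0 < ∫ s, s ∂μ := by
  have hnonneg : 0 ≤ᵐ[μ] fun s : ℝ => s := by filter_upwards [hμ] with s hs using hs.1.le
  refine lt_of_le_of_ne (integral_nonneg_of_ae hnonneg) fun h => ?_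
  have h0 := (integral_eq_zero_iff_of_nonneg_ae hnonneg (integrable_id_of_ae_mem_Ioc hμ)).1 h.symm
  obtain ⟨s, hs, hs0⟩ := (hμ.and h0).exists
  exact hs.1.ne' hs0

lemma integral_le_one_of_ae_mem_Ioc (hμ : ∀ᵐ s ∂μ, s ∈ Ioc (0:ℝ) 1) : ∫ s, s ∂μ ≤ 1 := by
  have h : (fun s : ℝ => s) ≤ᵐ[μ] fun _ => 1 := by filter_upwards [hμ] with s hs using hs.2
  simpa using integral_mono_ae (integrable_id_of_ae_mem_Ioc hμ) (integrable_const 1) h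

end

/-- For a probability measure `μ` on `[0,1]` with `μ({0}) = 0` not in `𝒫′`, with
`m_μ = ∫_{(0,1)} z·ψ′_μ(z) dz`, there exist reals `a, b, c, d` with `a < 0 < d`,
`a < b < c < d`, `2(c−b) = d−a`, `(a+d)/(a−d) + ψ_μ(2(b−a)/(d−a)) ≤ m_μ`,
`2b/(a−d) ≤ m_μ` and `m_μ < a/(a−d)`. -/
theorem exists_abcd (μ : Measure ℝ) [IsProbabilityMeasure μ]
    (hμsupp : μ (Set.Icc (0:ℝ) 1)ᶜ = 0) (hμ0 : μ {0} = 0) (hμP' : ¬ MemP' μ) :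
    ∃ a b c d : ℝ,
      (a < 0 ∧ 0 < d ∧ a < b ∧ b < c ∧ c < d ∧ 2 * (c - b) = d - a) ∧
      (a + d) / (a - d) + psiMu μ (2 * (b - a) / (d - a))
        ≤ (∫ z in Set.Ioo (0:ℝ) 1, z * psiMu' μ z) ∧
      2 * b / (a - d) ≤ (∫ z in Set.Ioo (0:ℝ) 1, z * psiMu' μ z) ∧
      (∫ z in Set.Ioo (0:ℝ) 1, z * psiMu' μ z) < a / (a - d) := by
  have hμ := ae_mem_Ioc hμsupp hμ0
  rw [setIntegral_id_mul_psiMu' hμ]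
  have hmean : ∫ s, s ∂μ = 2 * ((∫ s, s ∂μ) / 2) := by ring
  have hm0 : 0 < (∫ s, s ∂μ) / 2 := half_pos (integral_pos_of_ae_mem_Ioc hμ)
  have hm : (∫ s, s ∂μ) / 2 ≤ 1 / 2 := by linarith [integral_le_one_of_ae_mem_Ioc hμ]
  have hlt := integral_inv_mul_min_lt hμ hμP' hm0 hm hmean
  generalize (∫ s, s ∂μ) / 2 = m at hm0 hm hlt ⊢
  obtain ⟨t, hmt, ht1, hψ⟩ : ∃ t, m < t ∧ t < 1 ∧ psiMu μ t < 1 - m := by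
    have hcont : ContinuousAt (fun t => t / m * ∫ s, s⁻¹ * min s m ∂μ) m := by fun_prop
    have hev := hcont.eventually_lt continuousAt_const
      (show m / m * ∫ s, s⁻¹ * min s m ∂μ < 1 - m by rwa [div_self hm0.ne', one_mul])
    have hev' := (hev.and (eventually_lt_nhds (show m < 1 by linarith))).filter_mono
      (nhdsWithin_le_nhds (s := Ioi m))
    obtain ⟨t, ⟨h1, h2⟩, h3⟩ := (hev'.and self_mem_nhdsWithin).exists
    have h3 : m < t := h3
    refine ⟨t, h3, h2, ?_⟩
    rw [psiMu_eq_integral_min hμ (hm0.trans h3).le h2.le]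
    exact (integral_inv_mul_min_le_mul hμ hm0 h3.le).trans_lt h1
  -- Normalise `d - a = 2`, `a = -2 p` and `b = a + t`.
  obtain ⟨p, hmp, hp⟩ := exists_between
    (show m < min ((m + t) / 2) ((1 + m - psiMu μ t) / 2) from
      lt_min (by linarith) (by linarith))
  have hp1 := hp.trans_le (min_le_left _ _)
  have hp2 := hp.trans_le (min_le_right _ _)
  have hda : (2 - 2 * p) - -2 * p = 2 := by ring
  have had : -2 * p - (2 - 2 * p) = -2 := by ring
  have harg : 2 * (-2 * p + t - -2 * p) / 2 = t := by ring
  refine ⟨-2 * p, -2 * p + t, -2 * p + t + 1, 2 - 2 * p, ?_, ?_, ?_, ?_⟩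
  · refine ⟨?_, ?_, ?_, ?_, ?_, ?_⟩ <;> linarith
  · rw [hda, had, harg]
    linarith
  · rw [had]
    linarith
  · rw [had]
    linarith
end

section
/- (Distortion risk measure of a uniform random variable.) Let ψ be a regular distortion function with right derivative ψ′₊, let a < 0 < d be real numbers, and let X be a random variable uniformly distributed on the interval [a,d]. Then ρ^ψ(X) = −a − (d−a)·∫_{(0,1)} z·ψ′₊(z) dz. -/
open MeasureTheory Set

/-- A distortion function: non-decreasing on `[0,1]` with `ψ 0 = 0` and `ψ 1 = 1`. -/
structure IsDistortion (ψ : ℝ → ℝ) : Prop where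
  mono : MonotoneOn ψ (Set.Icc 0 1)
  map_zero : ψ 0 = 0
  map_one : ψ 1 = 1

/-- A regular distortion function: a distortion function which is moreover concave and
continuous on `[0,1]`. -/
structure IsRegularDistortion (ψ : ℝ → ℝ) extends IsDistortion ψ : Prop where
  concave : ConcaveOn ℝ (Set.Icc 0 1) ψ
  cont : ContinuousOn ψ (Set.Icc 0 1)

/-- The static distortion risk measure
`ρ^ψ(X) = ∫_{[0,∞)} ψ(P{X < −y}) dy + ∫_{(−∞,0)} (ψ(P{X < −y}) − 1) dy`. -/
noncomputable def staticRho {Ω : Type*} [MeasurableSpace Ω]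
    (P : Measure Ω) (ψ : ℝ → ℝ) (X : Ω → ℝ) : ℝ :=
  (∫ y in Set.Ici (0:ℝ), ψ ((P {a | X a < -y}).toReal)) +
  ∫ y in Set.Iio (0:ℝ), (ψ ((P {a | X a < -y}).toReal) - 1)

/-- The cumulative distribution of a uniform random variable, at points between the endpoints. -/
lemma uniform_measure_lt_toReal {Ω : Type*} [MeasurableSpace Ω] {P : Measure Ω}
    {a d : ℝ} {X : Ω → ℝ} (hX : Measurable X)
    (hunif : Measure.map X P = (ENNReal.ofReal (d - a))⁻¹ • volume.restrict (Icc a d))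
    {x : ℝ} (hax : a ≤ x) (hxd : x ≤ d) :
    (P {ω | X ω < x}).toReal = (x - a) / (d - a) := by
  have h : P {ω | X ω < x} = Measure.map X P (Iio x) :=
    (Measure.map_apply hX measurableSet_Iio).symm
  have hs : Iio x ∩ Icc a d = Ico a x := by
    ext y
    simp only [mem_inter_iff, mem_Iio, mem_Icc, mem_Ico]
    exact ⟨fun h => ⟨h.2.1, h.1⟩, fun h => ⟨h.2, h.1, h.2.le.trans hxd⟩⟩
  rw [h, hunif, Measure.smul_apply, Measure.restrict_apply measurableSet_Iio, hs,
    Real.volume_Ico, smul_eq_mul, ENNReal.toReal_mul, ENNReal.toReal_inv,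
    ENNReal.toReal_ofReal (by linarith), ENNReal.toReal_ofReal (by linarith)]
  ring

/-- Integration by parts for a regular distortion function. -/
lemma IsRegularDistortion.integral_mul_rightDeriv {ψ : ℝ → ℝ} (hψ : IsRegularDistortion ψ)
    {ψ' : ℝ → ℝ} (hψ' : ∀ z ∈ Ioo (0:ℝ) 1, HasDerivWithinAt ψ (ψ' z) (Ici z) z) :
    ∫ z in Ioo (0:ℝ) 1, z * ψ' z = 1 - ∫ z in (0:ℝ)..1, ψ z := by
  have hpos : ∀ z ∈ Ioo (0:ℝ) 1, 0 ≤ ψ z := fun z hz =>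
    hψ.map_zero ▸ hψ.mono (left_mem_Icc.2 zero_le_one) ⟨hz.1.le, hz.2.le⟩ hz.1.le
  have hder : ∀ z ∈ Ioo (0:ℝ) 1, HasDerivWithinAt ψ (ψ' z) (Ioi z) z := fun z hz =>
    (hψ' z hz).mono Ioi_subset_Ici_self
  have hder_nonneg : ∀ z ∈ Ioo (0:ℝ) 1, 0 ≤ ψ' z := by
    intro z hz
    refine ge_of_tendsto (hasDerivWithinAt_iff_tendsto_slope' (by simp) |>.1 (hder z hz)) ?_
    filter_upwards [Ioo_mem_nhdsGT hz.2] with y hy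
    rw [slope_def_field]
    exact div_nonneg (sub_nonneg.2 (hψ.mono ⟨hz.1.le, hz.2.le⟩
      ⟨hz.1.le.trans hy.1.le, hy.2.le⟩ hy.1.le)) (sub_nonneg.2 hy.1.le)
  have hcont : ContinuousOn (fun z => z * ψ z) (Icc 0 1) := continuousOn_id.mul hψ.cont
  have hprod : ∀ z ∈ Ioo (0:ℝ) 1,
      HasDerivWithinAt (fun z => z * ψ z) (ψ z + z * ψ' z) (Ioi z) z := fun z hz => by
    simpa only [one_mul] using! (hasDerivWithinAt_id z (Ioi z)).mul (hder z hz)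
  have hint : IntervalIntegrable (fun z => ψ z + z * ψ' z) volume 0 1 :=
    (intervalIntegrable_iff_integrableOn_Ioc_of_le zero_le_one).2
      (intervalIntegral.integrableOn_deriv_right_of_nonneg hcont hprod
        fun z hz => add_nonneg (hpos z hz) (mul_nonneg hz.1.le (hder_nonneg z hz)))
  have hψint : IntervalIntegrable ψ volume 0 1 :=
    hψ.cont.intervalIntegrable_of_Icc zero_le_one
  have hFTC := intervalIntegral.integral_eq_sub_of_hasDeriv_right_of_le zero_le_one hcont hprod hint
  have hsub := intervalIntegral.integral_sub hint hψint
  simp only [add_sub_cancel_left] at hsub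
  rw [← integral_Ioc_eq_integral_Ioo, ← intervalIntegral.integral_of_le zero_le_one, hsub, hFTC,
    hψ.map_one]
  ring

/-- Distortion risk measure of a uniform random variable on `[a,d]` with `a < 0 < d`:
`ρ^ψ(X) = −a − (d−a)·∫_{(0,1)} z·ψ′₊(z) dz`, where `ψ′₊` is the right derivative of `ψ`. -/
theorem staticRho_uniform {Ω : Type*} [MeasurableSpace Ω]
    (P : Measure Ω) [IsProbabilityMeasure P]
    (ψ : ℝ → ℝ) (hψ : IsRegularDistortion ψ)
    (ψ' : ℝ → ℝ) (hψ' : ∀ z ∈ Set.Ioo (0:ℝ) 1, HasDerivWithinAt ψ (ψ' z) (Set.Ici z) z)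
    (a d : ℝ) (ha : a < 0) (hd : 0 < d)
    (X : Ω → ℝ) (hX : Measurable X)
    (hunif : Measure.map X P
      = (ENNReal.ofReal (d - a))⁻¹ • volume.restrict (Set.Icc a d)) :
    staticRho P ψ X = -a - (d - a) * ∫ z in Set.Ioo (0:ℝ) 1, z * ψ' z := by
  have hda : 0 < d - a := by linarith
  set G : ℝ → ℝ := fun x => ψ ((P {ω | X ω < x}).toReal) with hG
  have hcdf : ∀ x ∈ Icc a d, G x = ψ ((x - a) / (d - a)) := fun x hx => by
    rw [hG]
    exact congrArg ψ (uniform_measure_lt_toReal hX hunif hx.1 hx.2)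
  have hlow : ∀ x ≤ a, G x = 0 := fun x hx => by
    have h : (P {ω | X ω < x}).toReal ≤ (P {ω | X ω < a}).toReal :=
      ENNReal.toReal_mono (measure_ne_top _ _) (measure_mono fun ω hω => lt_of_lt_of_le hω hx)
    rw [uniform_measure_lt_toReal hX hunif le_rfl (by linarith), sub_self, zero_div] at h
    simp only [hG, le_antisymm h ENNReal.toReal_nonneg, hψ.map_zero]
  have hhigh : ∀ x, d ≤ x → G x = 1 := fun x hx => by
    have h : (P {ω | X ω < d}).toReal ≤ (P {ω | X ω < x}).toReal :=
      ENNReal.toReal_mono (measure_ne_top _ _) (measure_mono fun ω hω => lt_of_lt_of_le hω hx)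
    rw [uniform_measure_lt_toReal hX hunif (by linarith) le_rfl, div_self hda.ne'] at h
    have h1 : (P {ω | X ω < x}).toReal ≤ 1 := ENNReal.toReal_le_of_le_ofReal zero_le_one
      (by simpa using prob_le_one)
    simp only [hG, le_antisymm h1 h, hψ.map_one]
  have hGcont : ContinuousOn G (Icc a d) := by
    refine ContinuousOn.congr (hψ.cont.comp (f := fun x => (x - a) / (d - a))
      (by fun_prop) fun x hx => ?_) hcdf
    exact ⟨div_nonneg (by linarith [hx.1]) hda.le, (div_le_one hda).2 (by linarith [hx.2])⟩
  have hI₁ : IntervalIntegrable G volume a 0 :=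
    (hGcont.mono (Icc_subset_Icc_right hd.le)).intervalIntegrable_of_Icc ha.le
  have hI₂ : IntervalIntegrable G volume 0 d :=
    (hGcont.mono (Icc_subset_Icc_left ha.le)).intervalIntegrable_of_Icc hd.le
  have hneg : ∫ y in Ici (0:ℝ), G (-y) = ∫ x in a..0, G x := by
    rw [integral_Ici_eq_integral_Ioi, integral_comp_neg_Ioi, neg_zero,
      intervalIntegral.integral_of_le ha.le]
    refine setIntegral_eq_of_subset_of_forall_sdiff_eq_zero measurableSet_Iic
      Ioc_subset_Iic_self fun x hx => hlow x ?_
    by_contra! h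
    exact hx.2 ⟨h, hx.1⟩
  have hpos : ∫ y in Iio (0:ℝ), (G (-y) - 1) = (∫ x in (0:ℝ)..d, G x) - d := by
    have h : ∫ y in Iio (0:ℝ), (G (-y) - 1) = ∫ x in (0:ℝ)..d, (G x - 1) := by
      rw [← integral_Iic_eq_integral_Iio, integral_comp_neg_Iic 0 (fun x => G x - 1), neg_zero,
        intervalIntegral.integral_of_le hd.le]
      refine setIntegral_eq_of_subset_of_forall_sdiff_eq_zero measurableSet_Ioi
        Ioc_subset_Ioi_self fun x hx => sub_eq_zero.2 (hhigh x ?_)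
      by_contra! h
      exact hx.2 ⟨hx.1, h.le⟩
    rw [h, intervalIntegral.integral_sub hI₂ intervalIntegrable_const]
    simp
  have hscale : ∫ x in a..d, G x = (d - a) * ∫ z in (0:ℝ)..1, ψ z := by
    have h : ∫ x in a..d, G x = ∫ x in a..d, ψ ((x - a) / (d - a)) :=
      intervalIntegral.integral_congr fun x hx => hcdf x (by rwa [uIcc_of_le (by linarith)] at hx)
    rw [h, intervalIntegral.integral_comp_sub_right (fun x => ψ (x / (d - a))),
      intervalIntegral.integral_comp_div _ hda.ne', sub_self, zero_div, div_self hda.ne',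
      smul_eq_mul]
  have hrho : staticRho P ψ X = (∫ x in a..0, G x) + ((∫ x in (0:ℝ)..d, G x) - d) := by
    rw [← hneg, ← hpos]
    rfl
  rw [hrho, hψ.integral_mul_rightDeriv hψ', ← add_sub_assoc,
    intervalIntegral.integral_add_adjacent_intervals hI₁ hI₂, hscale]
  ring
end

section
/- (Key inequality for distorted probabilities of simple random variables.) Let (Ω, 𝓕, P) be a probability space, ψ a regular distortion function, and A₁, …, A_n a measurable partition of Ω. Set B₀ := ∅, B_k := A₁ ∪ … ∪ A_k for 1 ≤ k ≤ n, and define q_k := ψ(P(B_k)) − ψ(P(B_{k−1})). Then for any real numbers x₁, …, x_n, letting X := Σ_{i=1}^n x_i·1_{A_i}, one has Σ_{i=1}^n (−x_i)·q_i ≤ ρ^ψ(X); moreover, if x₁ ≤ x₂ ≤ … ≤ x_n, then Σ_{i=1}^n (−x_i)·q_i = ρ^ψ(X). -/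
open MeasureTheory Set

/-- Increments of a concave function over steps of equal length decrease. -/
theorem ConcaveOn.sub_le_sub_of_le {f : ℝ → ℝ} {s : Set ℝ} (hf : ConcaveOn ℝ s f)
    {a b p : ℝ} (hab : a ≤ b) (hp : 0 ≤ p) (ha : a ∈ s) (hbp : b + p ∈ s) :
    f (b + p) - f b ≤ f (a + p) - f a := by
  rcases (show 0 ≤ b + p - a by linarith).eq_or_lt with h | h
  · obtain rfl : p = 0 := by linarith
    simp
  · have hne : b + p - a ≠ 0 := h.ne'
    have hl : 0 ≤ p / (b + p - a) := by positivity
    have hr : 0 ≤ (b - a) / (b + p - a) := div_nonneg (by linarith) h.le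
    have hsum : (b - a) / (b + p - a) + p / (b + p - a) = 1 := by
      field_simp; ring
    have h₁ := hf.2 ha hbp hr hl hsum
    have h₂ := hf.2 ha hbp hl hr (by rw [add_comm, hsum])
    have e₁ : ((b - a) / (b + p - a)) • a + (p / (b + p - a)) • (b + p) = a + p := by
      simp only [smul_eq_mul]; field_simp; ring
    have e₂ : (p / (b + p - a)) • a + ((b - a) / (b + p - a)) • (b + p) = b := by
      simp only [smul_eq_mul]; field_simp; ring
    rw [e₁] at h₁
    rw [e₂] at h₂
    simp only [smul_eq_mul] at h₁ h₂
    have e₃ : (b - a) / (b + p - a) = 1 - p / (b + p - a) := by linarith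
    rw [e₃] at h₁ h₂
    linarith

section PartialSums

variable {f : ℝ → ℝ} {p : ℕ → ℝ} {n : ℕ} (S : ℕ → Prop) [DecidablePred S]

/-- For a concave function vanishing at zero, the increments along the partial sums of `p`,
summed over the indices in `S`, are at most the value at the sum of `p` over `S`. -/
theorem ConcaveOn.sum_increments_le (hf : ConcaveOn ℝ (Icc 0 1) f) (hf0 : f 0 = 0)
    (hp : ∀ i < n, 0 ≤ p i) (hp1 : ∑ i ∈ Finset.range n, p i ≤ 1) :
    ∑ i ∈ Finset.range n, (if S i then 1 else 0) *
        (f (∑ j ∈ Finset.range (i + 1), p j) - f (∑ j ∈ Finset.range i, p j)) ≤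
      f (∑ i ∈ Finset.range n, if S i then p i else 0) := by
  induction n with
  | zero => simp [hf0]
  | succ m ih =>
    have hpm := hp m (by simp)
    have hp' : ∀ i < m, 0 ≤ p i := fun i hi => hp i (by omega)
    have hsum : ∑ i ∈ Finset.range m, p i + p m ≤ 1 := by rwa [← Finset.sum_range_succ]
    specialize ih hp' (by linarith)
    rw [Finset.sum_range_succ, Finset.sum_range_succ (fun i => if S i then p i else 0)]
    by_cases hS : S m
    · have h₀ : 0 ≤ ∑ i ∈ Finset.range m, if S i then p i else 0 :=
        Finset.sum_nonneg fun i hi => by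
          have := hp' i (Finset.mem_range.1 hi)
          split_ifs <;> simp [this]
      have h₁ : ∑ i ∈ Finset.range m, (if S i then p i else 0) ≤ ∑ i ∈ Finset.range m, p i :=
        Finset.sum_le_sum fun i hi => by
          have := hp' i (Finset.mem_range.1 hi)
          split_ifs <;> simp [this]
      have := hf.sub_le_sub_of_le h₁ hpm ⟨h₀, by linarith⟩ ⟨by linarith, hsum⟩
      simp only [hS, if_true, one_mul, Finset.sum_range_succ p m]
      linarith
    · simpa [hS] using ih

/-- The increments of a function along the partial sums of `p` telescope over an initial segment
of the indices. -/
theorem sum_increments_eq_of_initial (hf0 : f 0 = 0)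
    (hS : ∀ i j, i ≤ j → j < n → S j → S i) :
    ∑ i ∈ Finset.range n, (if S i then 1 else 0) *
        (f (∑ j ∈ Finset.range (i + 1), p j) - f (∑ j ∈ Finset.range i, p j)) =
      f (∑ i ∈ Finset.range n, if S i then p i else 0) := by
  induction n with
  | zero => simp [hf0]
  | succ m ih =>
    specialize ih fun i j hij hj => hS i j hij (by omega)
    rw [Finset.sum_range_succ, Finset.sum_range_succ (fun i => if S i then p i else 0), ih]
    by_cases hm : S m
    · have h : ∑ i ∈ Finset.range m, (if S i then p i else 0) = ∑ i ∈ Finset.range m, p i :=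
        Finset.sum_congr rfl fun i hi =>
          if_pos (hS i m (Finset.mem_range.1 hi).le (by omega) hm)
      simp [hm, h, Finset.sum_range_succ p m]
    · simp [hm]

end PartialSums

section Choquet

variable {F : ℝ → ℝ} {M : ℝ}

theorem Antitone.integrableOn_Ici_of_eventually_zero (hF : Antitone F)
    (h0 : ∀ y, M ≤ y → F y = 0) : IntegrableOn F (Ici 0) := by
  refine ((hF.antitoneOn _).integrableOn_isCompact
    (isCompact_Icc (a := 0) (b := M))).of_forall_sdiff_eq_zero
    measurableSet_Ici fun y hy => h0 y ?_
  by_contra! h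
  exact hy.2 ⟨hy.1, h.le⟩

theorem Antitone.integrableOn_Iio_sub_one (hF : Antitone F)
    (h1 : ∀ y, y < -M → F y = 1) : IntegrableOn (fun y => F y - 1) (Iio 0) := by
  have hG : Antitone fun y => F y - 1 := fun a b h => sub_le_sub_right (hF h) 1
  refine ((hG.antitoneOn _).integrableOn_isCompact
    (isCompact_Icc (a := -M) (b := 0))).of_forall_sdiff_eq_zero
    measurableSet_Iio fun y hy => ?_
  rw [h1 y, sub_self]
  by_contra! h
  exact hy.2 ⟨h, le_of_lt hy.1⟩

theorem antitone_ite_lt_neg (x : ℝ) : Antitone fun y : ℝ => if x < -y then (1 : ℝ) else 0 := by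
  intro a b h
  dsimp only
  split_ifs <;> first | (exfalso; linarith) | norm_num

theorem integrableOn_Ici_ite_lt_neg (x : ℝ) :
    IntegrableOn (fun y : ℝ => if x < -y then (1 : ℝ) else 0) (Ici 0) :=
  (antitone_ite_lt_neg x).integrableOn_Ici_of_eventually_zero (M := -x)
    fun y hy => if_neg (by linarith)

theorem integrableOn_Iio_ite_lt_neg_sub_one (x : ℝ) :
    IntegrableOn (fun y : ℝ => (if x < -y then (1 : ℝ) else 0) - 1) (Iio 0) :=
  (antitone_ite_lt_neg x).integrableOn_Iio_sub_one (M := x)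
    fun y hy => if_pos (by linarith)

/-- The layer-cake representation of a real number. -/
theorem integral_Ici_add_integral_Iio_ite_lt_neg (x : ℝ) :
    (∫ y in Ici (0 : ℝ), if x < -y then (1 : ℝ) else 0) +
      ∫ y in Iio (0 : ℝ), ((if x < -y then (1 : ℝ) else 0) - 1) = -x := by
  have e₁ : (fun y : ℝ => if x < -y then (1 : ℝ) else 0) = (Iio (-x)).indicator 1 := by
    ext y
    simp [indicator_apply, lt_neg]
  have e₂ : (fun y : ℝ => (if x < -y then (1 : ℝ) else 0) - 1) =
      (Ici (-x)).indicator fun _ => -1 := by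
    ext y
    simp only [indicator_apply, mem_Ici]
    split_ifs <;> first | (exfalso; linarith) | norm_num
  rw [e₁, e₂, setIntegral_indicator measurableSet_Iio, setIntegral_indicator measurableSet_Ici,
    Ici_inter_Iio, Iio_inter_Ici]
  rcases le_total x 0 with h | h
  · simp [h]
  · simp [h]

theorem sum_ite_mul_sub_one {n : ℕ} {x q : ℕ → ℝ} (hq : ∑ i ∈ Finset.range n, q i = 1) (y : ℝ) :
    ∑ i ∈ Finset.range n, (if x i < -y then 1 else 0) * q i - 1 =
      ∑ i ∈ Finset.range n, ((if x i < -y then 1 else 0) - 1) * q i := by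
  simp [sub_mul, Finset.sum_sub_distrib, hq]

theorem integrableOn_sum_ite_Ici (n : ℕ) (x q : ℕ → ℝ) :
    IntegrableOn (fun y : ℝ => ∑ i ∈ Finset.range n, (if x i < -y then 1 else 0) * q i) (Ici 0) :=
  integrable_finsetSum _ fun i _ => (integrableOn_Ici_ite_lt_neg (x i)).mul_const _

theorem integrableOn_sum_ite_Iio {n : ℕ} {x q : ℕ → ℝ} (hq : ∑ i ∈ Finset.range n, q i = 1) :
    IntegrableOn (fun y : ℝ => ∑ i ∈ Finset.range n, (if x i < -y then 1 else 0) * q i - 1)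
      (Iio 0) := by
  simp only [sum_ite_mul_sub_one hq]
  exact integrable_finsetSum _ fun i _ =>
    (integrableOn_Iio_ite_lt_neg_sub_one (x i)).mul_const _

/-- A finite mixture of layer-cake representations. -/
theorem sum_neg_mul_eq_integral {n : ℕ} {x q : ℕ → ℝ} (hq : ∑ i ∈ Finset.range n, q i = 1) :
    ∑ i ∈ Finset.range n, -x i * q i =
      (∫ y in Ici (0 : ℝ), ∑ i ∈ Finset.range n, (if x i < -y then 1 else 0) * q i) +
      ∫ y in Iio (0 : ℝ), (∑ i ∈ Finset.range n, (if x i < -y then 1 else 0) * q i - 1) := by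
  simp only [sum_ite_mul_sub_one hq]
  rw [integral_finsetSum _ fun i _ => (integrableOn_Ici_ite_lt_neg (x i)).mul_const _,
    integral_finsetSum _ fun i _ => (integrableOn_Iio_ite_lt_neg_sub_one (x i)).mul_const _,
    ← Finset.sum_add_distrib]
  refine Finset.sum_congr rfl fun i _ => ?_
  rw [integral_mul_const, integral_mul_const, ← add_mul,
    integral_Ici_add_integral_Iio_ite_lt_neg]

end Choquet

/-- Key inequality for distorted probabilities of simple random variables: for a measurable
partition `A 0, …, A (n−1)` of `Ω`, with `B k = A 0 ∪ … ∪ A (k−1)` and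
`q i = ψ(P(B (i+1))) − ψ(P(B i))`, and `X = Σ_i x i · 1_{A i}`, one has
`Σ_i (−x i)·q i ≤ ρ^ψ(X)`, with equality when `x 0 ≤ x 1 ≤ … ≤ x (n−1)`. -/
theorem staticRho_simple_key_inequality {Ω : Type*} [MeasurableSpace Ω]
    (P : Measure Ω) [IsProbabilityMeasure P]
    (ψ : ℝ → ℝ) (hψ : IsRegularDistortion ψ)
    (n : ℕ) (A : ℕ → Set Ω)
    (hAmeas : ∀ i < n, MeasurableSet (A i))
    (hAdisj : ∀ i < n, ∀ j < n, i ≠ j → Disjoint (A i) (A j))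
    (hAcover : (⋃ i ∈ Finset.range n, A i) = Set.univ)
    (x : ℕ → ℝ)
    (X : Ω → ℝ) (hX : X = fun ω => ∑ i ∈ Finset.range n, (A i).indicator (fun _ => x i) ω)
    (B : ℕ → Set Ω) (hB : B = fun k => ⋃ i ∈ Finset.range k, A i)
    (q : ℕ → ℝ) (hq : q = fun i => ψ ((P (B (i + 1))).toReal) - ψ ((P (B i)).toReal)) :
    (∑ i ∈ Finset.range n, (-(x i)) * q i ≤ staticRho P ψ X) ∧
      ((∀ i j, i ≤ j → j < n → x i ≤ x j) →
        ∑ i ∈ Finset.range n, (-(x i)) * q i = staticRho P ψ X) := by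
  subst hX hB hq
  set p : ℕ → ℝ := fun i => P.real (A i) with hp
  have hPB : ∀ k ≤ n, (P (⋃ i ∈ Finset.range k, A i)).toReal = ∑ i ∈ Finset.range k, p i :=
    fun k hk => measureReal_biUnion_finset
      (fun i hi j hj hij => hAdisj i (by simp at hi; omega) j (by simp at hj; omega) hij)
      (fun i hi => hAmeas i (by simp at hi; omega))
  have hp1 : ∑ i ∈ Finset.range n, p i = 1 := by
    rw [← hPB n le_rfl, hAcover]
    simp
  have hX : ∀ i < n, ∀ ω ∈ A i,
      ∑ j ∈ Finset.range n, (A j).indicator (fun _ => x j) ω = x i := fun i hi ω hω => by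
    rw [Finset.sum_eq_single_of_mem i (Finset.mem_range.2 hi), indicator_of_mem hω]
    exact fun j hj hji => indicator_of_notMem
      (fun h => (hAdisj j (Finset.mem_range.1 hj) i hi hji).notMem_of_mem_left h hω) _
  have hcdf : ∀ t, (P {ω | ∑ i ∈ Finset.range n, (A i).indicator (fun _ => x i) ω < t}).toReal =
      ∑ i ∈ Finset.range n, if x i < t then p i else 0 := fun t => by
    have hset : {ω | ∑ i ∈ Finset.range n, (A i).indicator (fun _ => x i) ω < t} =
        ⋃ i ∈ (Finset.range n).filter (fun i => x i < t), A i := by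
      ext ω
      simp only [mem_ofPred_eq, mem_iUnion, Finset.mem_filter, Finset.mem_range, exists_prop]
      constructor
      · intro h
        have hω : ω ∈ ⋃ i ∈ Finset.range n, A i := hAcover ▸ mem_univ ω
        simp only [mem_iUnion, Finset.mem_range, exists_prop] at hω
        obtain ⟨i, hi, hω⟩ := hω
        exact ⟨i, ⟨hi, hX i hi ω hω ▸ h⟩, hω⟩
      · rintro ⟨i, ⟨hi, hit⟩, hω⟩
        rwa [hX i hi ω hω]
    rw [hset, ← Finset.sum_filter]
    exact measureReal_biUnion_finset
      (fun i hi j hj hij => hAdisj i (by simp at hi; omega) j (by simp at hj; omega) hij)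
      (fun i hi => hAmeas i (by simp at hi; omega))
  set q : ℕ → ℝ := fun i =>
    ψ (∑ j ∈ Finset.range (i + 1), p j) - ψ (∑ j ∈ Finset.range i, p j) with hq
  have hq1 : ∑ i ∈ Finset.range n, q i = 1 := by
    rw [hq, Finset.sum_range_sub fun k => ψ (∑ j ∈ Finset.range k, p j), hp1]
    simp [hψ.map_zero, hψ.map_one]
  have hlhs : ∑ i ∈ Finset.range n, -x i * (ψ (P (⋃ j ∈ Finset.range (i + 1), A j)).toReal -
      ψ (P (⋃ j ∈ Finset.range i, A j)).toReal) = ∑ i ∈ Finset.range n, -x i * q i :=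
    Finset.sum_congr rfl fun i hi => by
      have hi := Finset.mem_range.1 hi
      rw [hPB _ hi, hPB _ hi.le]
  simp only [staticRho, hcdf]
  rw [hlhs, sum_neg_mul_eq_integral hq1]
  refine ⟨?_, fun hx => ?_⟩
  · have hp0 : ∀ i, 0 ≤ p i := fun i => measureReal_nonneg
    have hle (y : ℝ) := hψ.concave.sum_increments_le (fun i => x i < -y) hψ.map_zero
      (fun i _ => hp0 i) hp1.le
    have hF : Antitone fun y : ℝ => ψ (∑ i ∈ Finset.range n, if x i < -y then p i else 0) := by
      have hmem : ∀ y : ℝ, (∑ i ∈ Finset.range n, if x i < -y then p i else 0) ∈ Icc (0 : ℝ) 1 :=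
        fun y => by
          rw [← hcdf]
          exact ⟨measureReal_nonneg, measureReal_le_one⟩
      intro a b hab
      refine hψ.mono (hmem b) (hmem a) (Finset.sum_le_sum fun i _ => ?_)
      have := hp0 i
      split_ifs <;> linarith
    obtain ⟨M, hM⟩ : ∃ M, ∀ i < n, |x i| ≤ M :=
      ⟨∑ i ∈ Finset.range n, |x i|, fun i hi =>
        Finset.single_le_sum (fun j _ => abs_nonneg (x j)) (Finset.mem_range.2 hi)⟩
    have hF0 : ∀ y, M ≤ y → ψ (∑ i ∈ Finset.range n, if x i < -y then p i else 0) = 0 :=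
      fun y hy => by
        rw [Finset.sum_eq_zero, hψ.map_zero]
        intro i hi
        have := (abs_le.1 (hM i (Finset.mem_range.1 hi))).1
        exact if_neg (by linarith)
    have hF1 : ∀ y, y < -M → ψ (∑ i ∈ Finset.range n, if x i < -y then p i else 0) = 1 :=
      fun y hy => by
        rw [Finset.sum_congr rfl (g := p), hp1, hψ.map_one]
        intro i hi
        have := (abs_le.1 (hM i (Finset.mem_range.1 hi))).2
        exact if_pos (by linarith)
    exact add_le_add
      (integral_mono (integrableOn_sum_ite_Ici n x q)
        (hF.integrableOn_Ici_of_eventually_zero hF0) hle)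
      (integral_mono (integrableOn_sum_ite_Iio hq1)
        (hF.integrableOn_Iio_sub_one hF1) fun y => sub_le_sub_right (hle y) 1)
  · have heq (y : ℝ) := sum_increments_eq_of_initial (f := ψ) (p := p) (n := n)
      (fun i => x i < -y) hψ.map_zero fun i j hij hj h => (hx i j hij hj).trans_lt h
    simp only [hq, heq]
end
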